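/- Let d ≥ 2 and q satisfy d ≡ 2 (mod 4) and q ≡ 3 (mod 4). If A ⊆ F_q^d is a square distance set, then (as an inequality of real numbers) |A| ≤ q^{d/2} + 2(q^{d/2} − q)/(q − 1 + 2q^{−(d−2)/2}). -/

import Mathlib

open Finset

/-- `‖x‖ = x₁² + ⋯ + x_d²` for `x ∈ F_q^d`. -/
def normSq {d : ℕ} {F : Type} [Field F] [Fintype F] (x : Fin d → F) : F := ∑ i, x i ^ 2

/-- `A` is a square distance set: every distance `‖x−y‖` (x, y ∈ A) is zero or a
nonzero square of `F_q`. -/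
def IsSquareDistanceSet {d : ℕ} {F : Type} [Field F] [Fintype F]
    (A : Finset (Fin d → F)) : Prop :=
  ∀ x ∈ A, ∀ y ∈ A, normSq (x - y) = 0 ∨ (IsSquare (normSq (x - y)) ∧ normSq (x - y) ≠ 0)

/-- The quadratic character of a finite field, with complex values. -/
noncomputable abbrev complexQuadraticChar (F : Type) [Field F] [Fintype F] [DecidableEq F] :
    MulChar F ℂ :=
  (quadraticChar F).ringHomComp (Int.castRingHom ℂ)

theorem AddChar.map_sum_eq_prod {R M ι : Type*} [AddCommMonoid R] [CommMonoid M]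
    (t : Finset ι) (ψ : AddChar R M) (f : ι → R) :
    ψ (∑ i ∈ t, f i) = ∏ i ∈ t, ψ (f i) :=
  map_prod ψ.toMonoidHom (fun i => Multiplicative.ofAdd (f i)) t

theorem sum_mul_norm_sum_addChar_sq {F : Type} [Field F] [Fintype F] {d : ℕ}
    (ψ : AddChar F ℂ) (A : Finset (Fin d → F)) (w : (Fin d → F) → ℝ) :
    ((∑ ξ, w ξ * ‖∑ a ∈ A, ψ (ξ ⬝ᵥ a)‖ ^ 2 : ℝ) : ℂ) =
      ∑ a ∈ A, ∑ b ∈ A, ∑ ξ, (w ξ : ℂ) * ψ (ξ ⬝ᵥ (a - b)) := by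
  have h (ξ : Fin d → F) : ((‖∑ a ∈ A, ψ (ξ ⬝ᵥ a)‖ : ℂ)) ^ 2 =
      ∑ a ∈ A, ∑ b ∈ A, ψ (ξ ⬝ᵥ (a - b)) := by
    rw [← Complex.mul_conj', map_sum, Finset.sum_mul_sum]
    simp_rw [← AddChar.map_neg_eq_conj, ← AddChar.map_add_eq_mul, dotProduct_sub, sub_eq_add_neg]
  push_cast
  simp_rw [h, Finset.mul_sum]
  rw [Finset.sum_comm]
  exact Finset.sum_congr rfl fun a _ => Finset.sum_comm

section GaussSums

variable {F : Type} [Field F] [Fintype F] [DecidableEq F]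

local notation "χ" => complexQuadraticChar F

theorem complexQuadraticChar_isQuadratic : (χ).IsQuadratic :=
  (quadraticChar_isQuadratic F).comp _

theorem complexQuadraticChar_ne_one (hF : ringChar F ≠ 2) : χ ≠ 1 :=
  (MulChar.ringHomComp_ne_one_iff (RingHom.injective_int _)).mpr (quadraticChar_ne_one hF)

theorem complexQuadraticChar_sq {a : F} (ha : a ≠ 0) : χ a ^ 2 = 1 := by
  have := quadraticChar_sq_one ha
  simp only [MulChar.ringHomComp_apply, eq_intCast]
  exact_mod_cast this

theorem complexQuadraticChar_inv (a : F) : χ a⁻¹ = χ a := by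
  rw [← MulChar.inv_apply', complexQuadraticChar_isQuadratic.inv]

theorem complexQuadraticChar_isSquare {a : F} (h : IsSquare a) (ha : a ≠ 0) : χ a = 1 := by
  simp [(quadraticChar_one_iff_isSquare ha).mpr h]

theorem complexQuadraticChar_neg_one (hq : Fintype.card F % 4 = 3) : χ (-1) = -1 := by
  have : quadraticChar F (-1) = -1 := by
    rw [quadraticChar_neg_one_iff_not_isSquare, FiniteField.isSquare_neg_one_iff]
    simpa using hq
  simp [this]

variable {ψ : AddChar F ℂ}

theorem sum_complexQuadraticChar_mul_addChar (hF : ringChar F ≠ 2) (ψ : AddChar F ℂ) (a : F) :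
    ∑ s, χ s * ψ (s * a) = χ a * gaussSum χ ψ := by
  by_cases ha : a = 0
  · simpa [ha] using MulChar.sum_eq_zero_of_ne_one (complexQuadraticChar_ne_one hF)
  · have h := gaussSum_mulShift_eq χ ψ (Units.mk0 a ha)
    rw [complexQuadraticChar_isQuadratic.inv] at h
    simpa [gaussSum, mul_comm a] using h

theorem sum_addChar_mul_sq (hF : ringChar F ≠ 2) (hψ : ψ.IsPrimitive) {s : F} (hs : s ≠ 0) :
    ∑ t, ψ (t ^ 2 * s) = χ s * gaussSum χ ψ := by
  have hfib (u : F) : ∑ t with t ^ 2 = u, ψ (t ^ 2 * s) = (χ u + 1) * ψ (u * s) := by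
    rw [Finset.sum_congr rfl (g := fun _ => ψ (u * s)) (by simp +contextual), Finset.sum_const,
      nsmul_eq_mul]
    congr 1
    have h := congrArg (Int.cast : ℤ → ℂ) (quadraticChar_card_sqrts hF u)
    simpa using h
  rw [← Finset.sum_fiberwise Finset.univ (fun t : F => t ^ 2)]
  simp_rw [hfib, add_mul, Finset.sum_add_distrib, one_mul,
    sum_complexQuadraticChar_mul_addChar hF, AddChar.sum_mulShift _ hψ]
  simp [hs]

theorem sum_addChar_quadratic (hF : ringChar F ≠ 2) (hψ : ψ.IsPrimitive) {s : F} (hs : s ≠ 0)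
    (x : F) :
    ∑ t, ψ (s * t ^ 2 + t * x) = χ s * gaussSum χ ψ * ψ (-(4 * s)⁻¹ * x ^ 2) := by
  have h2 : (2 : F) ≠ 0 := Ring.two_ne_zero hF
  have h4 : (4 : F) ≠ 0 := by
    rw [show (4 : F) = 2 * 2 by norm_num]; exact mul_ne_zero h2 h2
  rw [← sum_addChar_mul_sq hF hψ hs, Finset.sum_mul,
    ← Equiv.sum_comp (Equiv.addRight (x / (2 * s)))
      (fun t => ψ (t ^ 2 * s) * ψ (-(4 * s)⁻¹ * x ^ 2))]
  refine Finset.sum_congr rfl fun t _ => ?_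
  rw [← AddChar.map_add_eq_mul]
  congr 1
  simp only [Equiv.coe_addRight]
  field_simp
  ring

theorem sum_addChar_normSq (hF : ringChar F ≠ 2) (hψ : ψ.IsPrimitive) {s : F} (hs : s ≠ 0)
    {d : ℕ} (x : Fin d → F) :
    ∑ ξ : Fin d → F, ψ (s * normSq ξ + ξ ⬝ᵥ x) =
      (χ s * gaussSum χ ψ) ^ d * ψ (-(4 * s)⁻¹ * normSq x) := by
  simp_rw [normSq, dotProduct, Finset.mul_sum, ← Finset.sum_add_distrib, AddChar.map_sum_eq_prod]
  rw [← Fintype.piFinset_univ,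
    ← Finset.prod_univ_sum (fun _ => Finset.univ) (fun i t => ψ (s * t ^ 2 + t * x i))]
  simp_rw [sum_addChar_quadratic hF hψ hs, Finset.prod_mul_distrib, ← AddChar.map_sum_eq_prod]
  simp_rw [Finset.prod_const, Finset.card_univ, Fintype.card_fin, mul_pow]

theorem sum_addChar_dotProduct (hψ : ψ.IsPrimitive) {d : ℕ} (x : Fin d → F) :
    ∑ ξ : Fin d → F, ψ (ξ ⬝ᵥ x) = if x = 0 then (Fintype.card F : ℂ) ^ d else 0 := by
  simp_rw [dotProduct, AddChar.map_sum_eq_prod]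
  rw [← Fintype.piFinset_univ,
    ← Finset.prod_univ_sum (fun _ => Finset.univ) (fun i t => ψ (t * x i))]
  simp_rw [AddChar.sum_mulShift _ hψ]
  split_ifs with hx
  · simp [hx]
  · obtain ⟨i, hi⟩ := Function.ne_iff.mp hx
    exact Finset.prod_eq_zero (Finset.mem_univ i) (by simpa using hi)

/-- Twice the indicator function of the vectors whose norm is zero or a nonsquare. -/
noncomputable def nonsquareWeight {d : ℕ} (ξ : Fin d → F) : ℝ :=
  1 + (if normSq ξ = 0 then 1 else 0) - quadraticChar F (normSq ξ)

theorem nonsquareWeight_nonneg {d : ℕ} (ξ : Fin d → F) : 0 ≤ nonsquareWeight ξ := by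
  unfold nonsquareWeight
  split_ifs with h
  · simp [h]
  · rcases quadraticChar_dichotomy h with h' | h' <;> rw [h'] <;> norm_num

theorem nonsquareWeight_zero (d : ℕ) : nonsquareWeight (0 : Fin d → F) = 2 := by
  norm_num [nonsquareWeight, normSq]

theorem sum_nonsquareWeight_coeff (hF : ringChar F ≠ 2) (hψ : ψ.IsPrimitive)
    (hG : gaussSum χ ψ ≠ 0) (ε : ℂ) (a : F) :
    ∑ s, ((Fintype.card F : ℂ)⁻¹ + ε * χ s / gaussSum χ ψ) * ψ (s * a) =
      (if a = 0 then 1 else 0) + ε * χ a := by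
  have hq : (Fintype.card F : ℂ) ≠ 0 := Nat.cast_ne_zero.mpr Fintype.card_ne_zero
  have h1 := AddChar.sum_mulShift a hψ
  have h2 := sum_complexQuadraticChar_mul_addChar hF ψ a
  calc
    _ = (Fintype.card F : ℂ)⁻¹ * ∑ s, ψ (s * a) +
        ε / gaussSum χ ψ * ∑ s, χ s * ψ (s * a) := by
      rw [Finset.mul_sum, Finset.mul_sum, ← Finset.sum_add_distrib]
      exact Finset.sum_congr rfl fun s _ => by ring
    _ = _ := by
      rw [h1, h2]
      split_ifs
      · field_simp
      · push_cast
        field_simp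
        ring

/-- The Fourier transform of `nonsquareWeight` at vectors whose norm is zero or a square. -/
theorem sum_nonsquareWeight_mul_addChar (hq : Fintype.card F % 4 = 3) (hψ : ψ.IsPrimitive)
    {k : ℕ} (hk : Even k) {x : Fin (2 * (k + 1)) → F} (hx : IsSquare (normSq x)) :
    ∑ ξ, (nonsquareWeight ξ : ℂ) * ψ (ξ ⬝ᵥ x) =
      (if x = 0 then (Fintype.card F : ℂ) ^ (2 * k + 1) * (Fintype.card F + 1) else 0) -
        (Fintype.card F : ℂ) ^ k * (Fintype.card F - 1) := by
  have hF : ringChar F ≠ 2 := by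
    rw [Ne, FiniteField.even_card_iff_char_two]; lia
  have hq0 : (Fintype.card F : ℂ) ≠ 0 := Nat.cast_ne_zero.mpr Fintype.card_ne_zero
  have h4 : (4 : F) ≠ 0 := by
    rw [show (4 : F) = 2 * 2 by norm_num]
    exact mul_ne_zero (Ring.two_ne_zero hF) (Ring.two_ne_zero hF)
  have hG2 : gaussSum χ ψ ^ 2 = -Fintype.card F := by
    rw [gaussSum_sq (complexQuadraticChar_ne_one hF) complexQuadraticChar_isQuadratic hψ,
      complexQuadraticChar_neg_one hq, neg_one_mul]
  have hG : gaussSum χ ψ ≠ 0 := by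
    intro h
    rw [h] at hG2
    simp at hG2
  set q : ℂ := (Fintype.card F : ℂ)
  set G := gaussSum χ ψ
  have hw (ξ : Fin (2 * (k + 1)) → F) : (nonsquareWeight ξ : ℂ) =
      1 + ∑ s, (q⁻¹ + -1 * χ s / G) * ψ (s * normSq ξ) := by
    rw [sum_nonsquareWeight_coeff hF hψ hG]
    simp only [nonsquareWeight, MulChar.ringHomComp_apply, eq_intCast]
    split_ifs <;> (push_cast; ring)
  have hinner (s : F) : (q⁻¹ + -1 * χ s / G) * ∑ ξ, ψ (s * normSq ξ + ξ ⬝ᵥ x) =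
      -q ^ (k + 1) * ((q⁻¹ + -1 * χ s / G) * ψ (-(4 * s)⁻¹ * normSq x)) +
        if s = 0 then (if x = 0 then q ^ (2 * k + 1) else 0) + q ^ k else 0 := by
    by_cases hs : s = 0
    · simp only [hs, zero_mul, zero_add, sum_addChar_dotProduct hψ, MulChar.map_zero, mul_zero,
        inv_zero, neg_zero, AddChar.map_zero_eq_one, if_true]
      split_ifs <;> field_simp <;> ring
    · rw [sum_addChar_normSq hF hψ hs, if_neg hs, mul_pow, pow_mul, pow_mul,
        complexQuadraticChar_sq hs, hG2, hk.add_one.neg_pow]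
      ring
  have hinvol : Function.Involutive fun s : F => -(4 * s)⁻¹ := fun s => by
    by_cases hs : s = 0
    · simp [hs]
    · field_simp
  have hflip : ∑ s, (q⁻¹ + -1 * χ s / G) * ψ (-(4 * s)⁻¹ * normSq x) = 1 := by
    rw [← Equiv.sum_comp (hinvol.toPerm _)]
    have hχ (u : F) : χ (-(4 * u)⁻¹) = -χ u := by
      rw [← neg_one_mul, map_mul, complexQuadraticChar_neg_one hq, complexQuadraticChar_inv,
        map_mul, complexQuadraticChar_isSquare ⟨2, by norm_num⟩ h4]
      ring
    have hterm (u : F) : (q⁻¹ + -1 * χ (-(4 * u)⁻¹) / G) *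
        ψ (-(4 * -(4 * u)⁻¹)⁻¹ * normSq x) = (q⁻¹ + 1 * χ u / G) * ψ (u * normSq x) := by
      have h := hinvol u
      simp only at h
      rw [h, hχ]
      ring
    simp_rw [Function.Involutive.coe_toPerm, hterm]
    rw [sum_nonsquareWeight_coeff hF hψ hG]
    by_cases h0 : normSq x = 0
    · simp [h0]
    · rw [if_neg h0, complexQuadraticChar_isSquare hx h0]
      ring
  calc
    _ = ∑ ξ, ψ (ξ ⬝ᵥ x) + ∑ s, (q⁻¹ + -1 * χ s / G) * ∑ ξ, ψ (s * normSq ξ + ξ ⬝ᵥ x) := by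
      simp_rw [Finset.mul_sum]
      rw [Finset.sum_comm, ← Finset.sum_add_distrib]
      refine Finset.sum_congr rfl fun ξ _ => ?_
      simp_rw [hw ξ, AddChar.map_add_eq_mul, ← mul_assoc, ← Finset.sum_mul]
      ring
    _ = _ := by
      simp_rw [hinner]
      rw [Finset.sum_add_distrib, ← Finset.mul_sum, hflip, sum_addChar_dotProduct hψ]
      simp only [Finset.sum_ite_eq', Finset.mem_univ, if_true]
      split_ifs <;> ring

/-- The ratio bound for square distance sets, cleared of denominators. -/
theorem IsSquareDistanceSet.card_mul_le (hq : Fintype.card F % 4 = 3) {k : ℕ} (hk : Even k)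
    {A : Finset (Fin (2 * (k + 1)) → F)} (hA : IsSquareDistanceSet A) :
    (A.card : ℝ) * (2 + (Fintype.card F : ℝ) ^ k * (Fintype.card F - 1)) ≤
      (Fintype.card F : ℝ) ^ (2 * k + 1) * (Fintype.card F + 1) := by
  obtain ⟨ψ, hψ⟩ : ∃ ψ : AddChar F ℂ, ψ.IsPrimitive :=
    ⟨_, AddChar.FiniteField.primitiveChar_to_Complex_isPrimitive F⟩
  have hsum : ∑ ξ, nonsquareWeight ξ * ‖∑ a ∈ A, ψ (ξ ⬝ᵥ a)‖ ^ 2 =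
      A.card * ((Fintype.card F : ℝ) ^ (2 * k + 1) * (Fintype.card F + 1)) -
        A.card ^ 2 * ((Fintype.card F : ℝ) ^ k * (Fintype.card F - 1)) := by
    apply Complex.ofReal_injective
    rw [sum_mul_norm_sum_addChar_sq]
    have hsq (a) (ha : a ∈ A) (b) (hb : b ∈ A) : IsSquare (normSq (a - b)) := by
      rcases hA a ha b hb with h | h
      · simp [h]
      · exact h.1
    rw [Finset.sum_congr rfl fun a ha => Finset.sum_congr rfl fun b hb =>
      sum_nonsquareWeight_mul_addChar hq hψ hk (hsq a ha b hb)]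
    simp +contextual only [Finset.sum_sub_distrib, sub_eq_zero, Finset.sum_ite_eq, if_true,
      Finset.sum_const, nsmul_eq_mul]
    push_cast
    ring
  have hle : 2 * (A.card : ℝ) ^ 2 ≤ ∑ ξ, nonsquareWeight ξ * ‖∑ a ∈ A, ψ (ξ ⬝ᵥ a)‖ ^ 2 := by
    have h := Finset.single_le_sum
      (f := fun ξ => nonsquareWeight ξ * ‖∑ a ∈ A, ψ (ξ ⬝ᵥ a)‖ ^ 2)
      (fun ξ _ => mul_nonneg (nonsquareWeight_nonneg ξ) (sq_nonneg _))
      (Finset.mem_univ (0 : Fin (2 * (k + 1)) → F))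
    simpa [nonsquareWeight_zero] using h
  rw [hsum] at hle
  rcases A.eq_empty_or_nonempty with rfl | hne
  · simp only [Finset.card_empty, Nat.cast_zero, zero_mul]
    positivity
  · have hpos : (0 : ℝ) < A.card := by exact_mod_cast hne.card_pos
    refine le_of_mul_le_mul_left ?_ hpos
    linarith

end GaussSums

theorem squareDistanceSet_card_d2q3 (q d : ℕ) (F : Type) [Field F] [Fintype F] [DecidableEq F]
    (hcard : Fintype.card F = q) (hodd : Odd q)
    (hd : d % 4 = 2) (hq : q % 4 = 3) (hd2 : 2 ≤ d)
    (A : Finset (Fin d → F)) (hA : IsSquareDistanceSet A) :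
    (A.card : ℝ) ≤ (q : ℝ) ^ (d / 2)
      + 2 * ((q : ℝ) ^ (d / 2) - (q : ℝ)) / ((q : ℝ) - 1 + 2 / (q : ℝ) ^ ((d - 2) / 2)) := by
  obtain ⟨k, hk, rfl⟩ : ∃ k, Even k ∧ d = 2 * (k + 1) :=
    ⟨(d - 2) / 2, Nat.even_iff.mpr (by lia), by lia⟩
  subst hcard
  have h := hA.card_mul_le hq hk
  have hq1 : (1 : ℝ) < Fintype.card F := by exact_mod_cast Fintype.one_lt_card
  rw [show 2 * (k + 1) / 2 = k + 1 by lia, show (2 * (k + 1) - 2) / 2 = k by lia]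
  set q : ℝ := (Fintype.card F : ℝ)
  have hqk : 0 < q ^ k := by positivity
  have hden : 0 < q - 1 + 2 / q ^ k := by
    have := div_pos two_pos hqk
    linarith
  rw [← sub_le_iff_le_add', le_div_iff₀ hden, ← mul_le_mul_iff_left₀ hqk]
  have hcancel : (q - 1 + 2 / q ^ k) * q ^ k = 2 + q ^ k * (q - 1) := by
    field_simp
    ring
  rw [mul_assoc, hcancel]
  linear_combination h
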